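/- arXiv:1109.2662 — 6 statements merged into one kernel-verified Lean document; each statement's English description precedes it below -/
import Mathlib

section
/- Let 0 < a < 1 and define f(x) = \sqrt{1-a^2} / (π (1-x^2) \sqrt{a^2 - x^2}) for x in the open interval (-a, a). Then for every x ∈ (-a, a), f satisfies (1-x^2)(a^2-x^2) f''(x) - x(4a^2 + 3 - 7x^2) f'(x) + (9x^2 - 2a^2 - 1) f(x) = 0. -/
/-- The Konno limit density function of the discrete-time quantum walk. -/
noncomputable def konnoDensity (a : ℝ) : ℝ → ℝ :=
  fun x => Real.sqrt (1 - a ^ 2) / (Real.pi * (1 - x ^ 2) * Real.sqrt (a ^ 2 - x ^ 2))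

theorem hasDerivAt_konnoDensity {a x : ℝ} (hp : 1 - x ^ 2 ≠ 0) (hq : 0 < a ^ 2 - x ^ 2) :
    HasDerivAt (konnoDensity a)
      (x * (2 * a ^ 2 + 1 - 3 * x ^ 2) * konnoDensity a x / ((1 - x ^ 2) * (a ^ 2 - x ^ 2))) x := by
  have hs : Real.sqrt (a ^ 2 - x ^ 2) ≠ 0 := (Real.sqrt_pos.2 hq).ne'
  have hss : Real.sqrt (a ^ 2 - x ^ 2) ^ 2 = a ^ 2 - x ^ 2 := Real.sq_sqrt hq.le
  have hP : HasDerivAt (fun y : ℝ => 1 - y ^ 2) (-(2 * x)) x := by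
    simpa using (hasDerivAt_pow 2 x).const_sub 1
  have hQ : HasDerivAt (fun y : ℝ => a ^ 2 - y ^ 2) (-(2 * x)) x := by
    simpa using (hasDerivAt_pow 2 x).const_sub (a ^ 2)
  have hD := (hP.const_mul Real.pi).mul (hQ.sqrt hq.ne')
  have h := (hasDerivAt_const x (Real.sqrt (1 - a ^ 2))).div hD
    (mul_ne_zero (mul_ne_zero Real.pi_ne_zero hp) hs)
  refine h.congr_deriv ?_
  simp only [konnoDensity, Pi.mul_apply]
  rw [← hss, Real.sqrt_sq (Real.sqrt_nonneg _)]
  field_simp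
  rw [hss]
  ring

theorem konnoDensity_ode (a : ℝ) (ha0 : 0 < a) (ha1 : a < 1) :
    ∀ x ∈ Set.Ioo (-a) a,
      (1 - x ^ 2) * (a ^ 2 - x ^ 2) * deriv (deriv (konnoDensity a)) x
        - x * (4 * a ^ 2 + 3 - 7 * x ^ 2) * deriv (konnoDensity a) x
        + (9 * x ^ 2 - 2 * a ^ 2 - 1) * konnoDensity a x = 0 := by
  intro x hx
  have hpos : ∀ y ∈ Set.Ioo (-a) a, 0 < 1 - y ^ 2 ∧ 0 < a ^ 2 - y ^ 2 := fun y hy =>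
    ⟨by nlinarith [hy.1, hy.2], by nlinarith [hy.1, hy.2]⟩
  have hf : ∀ y ∈ Set.Ioo (-a) a, HasDerivAt (konnoDensity a) _ y := fun y hy =>
    hasDerivAt_konnoDensity (hpos y hy).1.ne' (hpos y hy).2
  have hp := (hpos x hx).1.ne'
  have hq := (hpos x hx).2.ne'
  have hderiv : deriv (konnoDensity a) =ᶠ[nhds x] fun y =>
      y * (2 * a ^ 2 + 1 - 3 * y ^ 2) * konnoDensity a y / ((1 - y ^ 2) * (a ^ 2 - y ^ 2)) := by
    filter_upwards [Ioo_mem_nhds hx.1 hx.2] with y hy using (hf y hy).deriv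
  have hsq : HasDerivAt (fun y : ℝ => y ^ 2) (2 * x) x := by
    simpa using hasDerivAt_pow 2 x
  have hnum := ((hasDerivAt_id' x).fun_mul ((hsq.const_mul 3).const_sub (2 * a ^ 2 + 1))).fun_mul
    (hf x hx)
  have hden := (hsq.const_sub 1).fun_mul (hsq.const_sub (a ^ 2))
  rw [hderiv.deriv_eq, (hnum.fun_div hden (mul_ne_zero hp hq)).deriv, (hf x hx).deriv]
  field_simp
  ring
end

section
/- (Theorem 1) Let 0 < a < 1 and define u(z) = \sqrt{1-a^2} / (π (1-z) \sqrt{a^2 - z}) for z in the open interval (0, a^2). Then for every z ∈ (0, a^2), u satisfies the Heun differential equation u''(z) + ( (1/2)/z + 2/(z-1) + (3/2)/(z-a^2) ) u'(z) + ( (9/4) z - (2a^2+1)/4 ) / ( z (z-1) (z-a^2) ) · u(z) = 0, i.e., the Heun equation with parameters α = β = 3/2, γ = 1/2, δ = 2, ε = 3/2, accessory parameter q = (2a^2+1)/4, and singular point θ = a^2. -/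
/-- The function obtained from the Konno density by the substitution `z = x ^ 2`. -/
noncomputable def konnoHeunSolution (a : ℝ) : ℝ → ℝ :=
  fun z => Real.sqrt (1 - a ^ 2) / (Real.pi * (1 - z) * Real.sqrt (a ^ 2 - z))

/-- The logarithmic derivative of the solution is `-1 / (z - 1) - 1 / (2 * (z - a ^ 2))`. -/
theorem hasDerivAt_konnoHeunSolution {a z : ℝ} (hz : z < a ^ 2) (hz1 : z ≠ 1) :
    HasDerivAt (konnoHeunSolution a)
      (konnoHeunSolution a z * (-(z - 1)⁻¹ - (z - a ^ 2)⁻¹ / 2)) z := by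
  have h1 : 1 - z ≠ 0 := sub_ne_zero.mpr hz1.symm
  have hpos : 0 < a ^ 2 - z := sub_pos.mpr hz
  have hs : √(a ^ 2 - z) ≠ 0 := (Real.sqrt_pos.mpr hpos).ne'
  have hsq : √(a ^ 2 - z) ^ 2 = a ^ 2 - z := Real.sq_sqrt hpos.le
  have hsqrt := ((hasDerivAt_id z).const_sub (a ^ 2)).sqrt hpos.ne'
  have hden := (((hasDerivAt_id z).const_sub 1).const_mul Real.pi).mul hsqrt
  have hne : Real.pi * (1 - z) * √(a ^ 2 - z) ≠ 0 :=
    mul_ne_zero (mul_ne_zero Real.pi_ne_zero h1) hs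
  refine ((hasDerivAt_const z √(1 - a ^ 2)).div hden hne).congr_deriv ?_
  have hz2 : z - a ^ 2 = -√(a ^ 2 - z) ^ 2 := by rw [hsq]; ring
  have hz3 : z - 1 = -(1 - z) := by ring
  simp only [konnoHeunSolution, id, Pi.mul_apply]
  rw [hz2, hz3]
  have hpi := Real.pi_ne_zero
  field_simp
  ring

/-- Theorem 1: the function `u^{(d)}` satisfies the Heun differential equation with
parameters `α = β = 3/2`, `γ = 1/2`, `δ = 2`, `ε = 3/2`, accessory parameter
`q = (2a²+1)/4` and singular point `θ = a²`. -/
theorem konnoHeunSolution_heun_equation (a : ℝ) (ha0 : 0 < a) (ha1 : a < 1) :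
    ∀ z ∈ Set.Ioo (0 : ℝ) (a ^ 2),
      deriv (deriv (konnoHeunSolution a)) z
        + ((1 / 2) / z + 2 / (z - 1) + (3 / 2) / (z - a ^ 2))
            * deriv (konnoHeunSolution a) z
        + ((9 / 4) * z - (2 * a ^ 2 + 1) / 4) / (z * (z - 1) * (z - a ^ 2))
            * konnoHeunSolution a z = 0 := by
  rintro z ⟨hz0, hza⟩
  have ha : a ^ 2 < 1 := pow_lt_one₀ ha0.le ha1 two_ne_zero
  have h0 : z ≠ 0 := hz0.ne'
  have h1 : z - 1 ≠ 0 := by linarith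
  have h2 : z - a ^ 2 ≠ 0 := sub_ne_zero.mpr hza.ne
  have hu := hasDerivAt_konnoHeunSolution hza (hza.trans ha).ne
  have hderiv : deriv (konnoHeunSolution a) =ᶠ[nhds z]
      fun w => konnoHeunSolution a w * (-(w - 1)⁻¹ - (w - a ^ 2)⁻¹ / 2) := by
    filter_upwards [Iio_mem_nhds hza] with w hw
    exact (hasDerivAt_konnoHeunSolution hw (lt_trans hw ha).ne).deriv
  have hp : HasDerivAt (fun w : ℝ => -(w - 1)⁻¹ - (w - a ^ 2)⁻¹ / 2)
      (-(-1 / (z - 1) ^ 2) - -1 / (z - a ^ 2) ^ 2 / 2) z :=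
    (((hasDerivAt_id z).sub_const 1).fun_inv h1).fun_neg.fun_sub
      ((((hasDerivAt_id z).sub_const (a ^ 2)).fun_inv h2).div_const 2)
  rw [hderiv.deriv_eq, (hu.fun_mul hp).deriv, hu.deriv]
  field_simp
  ring
end

section
/- (Theorem 2) Let ν > 0 and define u(z) = 1 / (2νπ \sqrt{1-z}) for z < 1. Then for every z < 1, u satisfies the Gauss hypergeometric differential equation z(z-1) u''(z) + (2z - 1/2) u'(z) + (1/4) u(z) = 0, i.e., the Gauss equation with parameters α = β = γ = 1/2. -/
/-- The function obtained from the arcsine-law density by the substitution `z = x²/(4ν²)`. -/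
noncomputable def arcsineGaussSolution (ν : ℝ) : ℝ → ℝ :=
  fun z => 1 / (2 * ν * Real.pi * Real.sqrt (1 - z))

/-- On `z < 1` the function satisfies the first-order equation `u' = u / (2 (1 - z))`. -/
theorem hasDerivAt_arcsineGaussSolution (ν : ℝ) {z : ℝ} (hz : z < 1) :
    HasDerivAt (arcsineGaussSolution ν) (arcsineGaussSolution ν z / (2 * (1 - z))) z := by
  have hpos : 0 < 1 - z := sub_pos.2 hz
  have hs : Real.sqrt (1 - z) ≠ 0 := (Real.sqrt_pos.2 hpos).ne'
  have hu : arcsineGaussSolution ν =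
      fun x => (2 * ν * Real.pi)⁻¹ * (Real.sqrt (1 - x))⁻¹ := by
    funext x
    rw [arcsineGaussSolution, one_div, mul_inv]
  have h := ((((hasDerivAt_id' z).const_sub 1).sqrt hpos.ne').fun_inv hs).const_mul
    (2 * ν * Real.pi)⁻¹
  rw [hu]
  refine h.congr_deriv ?_
  simp only [Real.sq_sqrt hpos.le, div_eq_mul_inv, mul_inv]
  ring

/-- Theorem 2: the function `u^{(c)}` satisfies the Gauss hypergeometric differential
equation with parameters `α = β = γ = 1/2`. -/
theorem arcsineGaussSolution_gauss_equation (ν : ℝ) (hν : 0 < ν) :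
    ∀ z : ℝ, z < 1 →
      z * (z - 1) * deriv (deriv (arcsineGaussSolution ν)) z
        + (2 * z - 1 / 2) * deriv (arcsineGaussSolution ν) z
        + (1 / 4) * arcsineGaussSolution ν z = 0 := by
  intro z hz
  have hne : 1 - z ≠ 0 := (sub_pos.2 hz).ne'
  have hu := hasDerivAt_arcsineGaussSolution ν hz
  have hderiv : deriv (arcsineGaussSolution ν) =ᶠ[nhds z]
      fun x => arcsineGaussSolution ν x / (2 * (1 - x)) := by
    filter_upwards [Iio_mem_nhds hz] with x hx
    exact (hasDerivAt_arcsineGaussSolution ν hx).deriv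
  have h2 := hu.fun_div (((hasDerivAt_id' z).const_sub 1).const_mul 2)
    (mul_ne_zero two_ne_zero hne)
  rw [hderiv.deriv_eq, h2.deriv, hu.deriv]
  field_simp
  ring
end

section
/- (Confluence of the Heun equation to the Gauss equation) Let (aₙ) be a sequence of reals in (0,1) and (τₙ) a sequence of positive reals with τₙ → ∞ and aₙ² τₙ → 1 as n → ∞. Then for every real t, the coefficients of the rescaled Heun equation converge to those of the Gauss equation: 4 t (aₙ² τₙ - t)(1 - t/τₙ) → 4 t (1 - t) = -4·t(t-1), 2 ( 8t²/τₙ - (5aₙ² + 4) t + aₙ² τₙ ) → 2 - 8t = -4·(2t - 1/2), and 9t/τₙ - 2aₙ² - 1 → -1 = -4·(1/4). Consequently the rescaled Heun equation 4t(aₙ²τₙ - t)(1 - t/τₙ)v'' + 2(8t²/τₙ - (5aₙ²+4)t + aₙ²τₙ)v' + (9t/τₙ - 2aₙ² - 1)v = 0 tends, coefficientwise after dividing by -4, to the Gauss equation t(t-1)v'' + (2t - 1/2)v' + (1/4)v = 0. -/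
open Filter Topology

/-- Confluence of the rescaled Heun equation to the Gauss equation: as `τₙ → ∞` and
`aₙ² τₙ → 1`, the three coefficient functions of the rescaled Heun equation converge
pointwise to `-4` times the corresponding coefficients of the Gauss equation
`t(t-1)v'' + (2t - 1/2)v' + (1/4)v = 0`. -/
theorem heun_confluence_to_gauss (a τ : ℕ → ℝ)
    (ha : ∀ n, a n ∈ Set.Ioo (0 : ℝ) 1) (hτ : ∀ n, 0 < τ n)
    (hτtop : Tendsto τ atTop atTop)
    (haτ : Tendsto (fun n => (a n) ^ 2 * τ n) atTop (𝓝 1)) :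
    ∀ t : ℝ,
      Tendsto (fun n => 4 * t * ((a n) ^ 2 * τ n - t) * (1 - t / τ n)) atTop
          (𝓝 (-4 * (t * (t - 1)))) ∧
      Tendsto (fun n => 2 * (8 * t ^ 2 / τ n - (5 * (a n) ^ 2 + 4) * t + (a n) ^ 2 * τ n))
          atTop (𝓝 (-4 * (2 * t - 1 / 2))) ∧
      Tendsto (fun n => 9 * t / τ n - 2 * (a n) ^ 2 - 1) atTop (𝓝 (-4 * (1 / 4))) := by
  have hdiv (c : ℝ) : Tendsto (fun n => c / τ n) atTop (𝓝 0) := hτtop.const_div_atTop c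
  have hsq : Tendsto (fun n => (a n) ^ 2) atTop (𝓝 0) := by
    refine (haτ.div_atTop hτtop).congr fun n => ?_
    exact mul_div_cancel_right₀ _ (hτ n).ne'
  intro t
  refine ⟨?_, ?_, ?_⟩
  · convert ((haτ.sub_const t).const_mul (4 * t)).mul ((hdiv t).const_sub 1) using 2
    ring
  · convert (((hdiv (8 * t ^ 2)).sub
      (((hsq.const_mul 5).add_const 4).mul_const t)).add haτ).const_mul 2 using 2
    ring
  · convert ((hdiv (9 * t)).sub (hsq.const_mul 2)).sub_const 1 using 2
    norm_num
end

section
/- Let 0 < a < 1 and define w(z) = \sqrt{1-a^2} / ( 2π (1-z) \sqrt{a^2 z - z^2} ) for z in the open interval (0, a^2). Then for every z ∈ (0, a^2), w satisfies the Heun differential equation w''(z) + ( (3/2)/z + 2/(z-1) + (3/2)/(z-a^2) ) w'(z) + ( 4z - (3a^2+2)/2 ) / ( z (z-1) (z-a^2) ) · w(z) = 0, i.e., the Heun equation with parameters α = β = 2, γ = 3/2, δ = 2, ε = 3/2, accessory parameter q = (3a^2+2)/2, and singular point θ = a^2. -/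
/-- The density of the pushforward of the discrete-time quantum walk limit measure
under `z = x²` (restricted to `x > 0`). -/
noncomputable def konnoMeasureDensity (a : ℝ) : ℝ → ℝ :=
  fun z => Real.sqrt (1 - a ^ 2) / (2 * Real.pi * (1 - z) * Real.sqrt (a ^ 2 * z - z ^ 2))

/-- The logarithmic derivative of `konnoMeasureDensity a`. -/
noncomputable def konnoMeasureLogDeriv (a z : ℝ) : ℝ :=
  -(1 / 2 / z + 1 / (z - 1) + 1 / 2 / (z - a ^ 2))

theorem hasDerivAt_konnoMeasureDensity {a z : ℝ} (h0 : 0 < z) (h1 : z ≠ 1) (h2 : z < a ^ 2) :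
    HasDerivAt (konnoMeasureDensity a) (konnoMeasureLogDeriv a z * konnoMeasureDensity a z) z := by
  have hP : 0 < a ^ 2 * z - z ^ 2 := by nlinarith [mul_pos h0 (sub_pos.2 h2)]
  have hs : Real.sqrt (a ^ 2 * z - z ^ 2) ≠ 0 := (Real.sqrt_pos.2 hP).ne'
  have hsq : Real.sqrt (a ^ 2 * z - z ^ 2) ^ 2 = a ^ 2 * z - z ^ 2 := Real.sq_sqrt hP.le
  have hz : 1 - z ≠ 0 := sub_ne_zero.2 h1.symm
  have hz' : z - 1 ≠ 0 := sub_ne_zero.2 h1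
  have hza : z - a ^ 2 ≠ 0 := (sub_neg.2 h2).ne
  have hpoly : HasDerivAt (fun x : ℝ => a ^ 2 * x - x ^ 2) (a ^ 2 - 2 * z) z := by
    refine (((hasDerivAt_id z).const_mul (a ^ 2)).sub ((hasDerivAt_id z).pow 2)).congr_deriv ?_
    simp
  have hlin : HasDerivAt (fun x : ℝ => 2 * Real.pi * (1 - x)) (-(2 * Real.pi)) z := by
    simpa using ((hasDerivAt_id z).const_sub 1).const_mul (2 * Real.pi)
  have hden := hlin.mul (hpoly.sqrt hP.ne')
  have hw := (hasDerivAt_const z (Real.sqrt (1 - a ^ 2))).div hden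
    (mul_ne_zero (mul_ne_zero (by positivity) hz) hs)
  refine hw.congr_deriv ?_
  have hlog : konnoMeasureLogDeriv a z =
      1 / (1 - z) - (a ^ 2 - 2 * z) / (2 * Real.sqrt (a ^ 2 * z - z ^ 2) ^ 2) := by
    rw [hsq, konnoMeasureLogDeriv, show a ^ 2 * z - z ^ 2 = -(z * (z - a ^ 2)) by ring,
      show 1 - z = -(z - 1) by ring]
    field_simp
    ring
  rw [hlog]
  simp only [konnoMeasureDensity, Pi.mul_apply]
  have hpi := Real.pi_ne_zero
  generalize Real.sqrt (a ^ 2 * z - z ^ 2) = s at *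
  field_simp
  ring

theorem hasDerivAt_konnoMeasureLogDeriv {a z : ℝ} (h0 : z ≠ 0) (h1 : z ≠ 1) (h2 : z ≠ a ^ 2) :
    HasDerivAt (konnoMeasureLogDeriv a)
      (1 / 2 / z ^ 2 + 1 / (z - 1) ^ 2 + 1 / 2 / (z - a ^ 2) ^ 2) z := by
  have key (c d : ℝ) (h : z ≠ d) :
      HasDerivAt (fun x : ℝ => c / (x - d)) (-(c / (z - d) ^ 2)) z := by
    refine ((hasDerivAt_const z c).div ((hasDerivAt_id z).sub_const d)
      (sub_ne_zero.2 h)).congr_deriv ?_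
    simp [neg_div]
  have h := (((key (1 / 2) 0 h0).add (key 1 1 h1)).add (key (1 / 2) (a ^ 2) h2)).neg
  simp only [sub_zero] at h
  refine h.congr_deriv ?_
  ring

/-- The measure-form density `w^{(d)}` satisfies the Heun equation with parameters
`α = β = 2`, `γ = 3/2`, `δ = 2`, `ε = 3/2`, `q = (3a²+2)/2`, `θ = a²`. -/
theorem konnoMeasureDensity_heun_equation (a : ℝ) (ha0 : 0 < a) (ha1 : a < 1) :
    ∀ z ∈ Set.Ioo (0 : ℝ) (a ^ 2),
      deriv (deriv (konnoMeasureDensity a)) z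
        + ((3 / 2) / z + 2 / (z - 1) + (3 / 2) / (z - a ^ 2))
            * deriv (konnoMeasureDensity a) z
        + (4 * z - (3 * a ^ 2 + 2) / 2) / (z * (z - 1) * (z - a ^ 2))
            * konnoMeasureDensity a z = 0 := by
  intro z hz
  have ha : a ^ 2 < 1 := by nlinarith
  have hD : ∀ x ∈ Set.Ioo (0 : ℝ) (a ^ 2), HasDerivAt (konnoMeasureDensity a)
      (konnoMeasureLogDeriv a x * konnoMeasureDensity a x) x := fun x hx =>
    hasDerivAt_konnoMeasureDensity hx.1 (hx.2.trans ha).ne hx.2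
  have hev : deriv (konnoMeasureDensity a) =ᶠ[nhds z]
      konnoMeasureLogDeriv a * konnoMeasureDensity a := by
    filter_upwards [isOpen_Ioo.mem_nhds hz] with x hx using (hD x hx).deriv
  have hL := hasDerivAt_konnoMeasureLogDeriv hz.1.ne' (hz.2.trans ha).ne hz.2.ne
  rw [hev.deriv_eq, (hL.mul (hD z hz)).deriv, (hD z hz).deriv]
  have h0 : z ≠ 0 := hz.1.ne'
  have h1 : z - 1 ≠ 0 := (sub_neg.2 (hz.2.trans ha)).ne
  have h2 : z - a ^ 2 ≠ 0 := (sub_neg.2 hz.2).ne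
  rw [konnoMeasureLogDeriv]
  field_simp
  ring
end

section
/- Let 0 < a < 1. Then the Konno density function integrates to one over its support: ∫_{-a}^{a} \sqrt{1-a^2} / ( π (1-x^2) \sqrt{a^2 - x^2} ) dx = 1. -/
open MeasureTheory

theorem hasDerivAt_div_sqrt_one_sub_sq {x : ℝ} (hx : x ^ 2 < 1) :
    HasDerivAt (fun y : ℝ ↦ y / Real.sqrt (1 - y ^ 2))
      (1 / (Real.sqrt (1 - x ^ 2)) ^ 3) x := by
  have hpos : 0 < 1 - x ^ 2 := by linarith
  have hs : 0 < Real.sqrt (1 - x ^ 2) := Real.sqrt_pos.2 hpos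
  have hsq : Real.sqrt (1 - x ^ 2) ^ 2 = 1 - x ^ 2 := Real.sq_sqrt hpos.le
  have h1 : HasDerivAt (fun y : ℝ ↦ 1 - y ^ 2) (-(2 * x)) x := by
    simpa using! ((hasDerivAt_id x).pow 2).const_sub 1
  refine ((hasDerivAt_id x).div (h1.sqrt hpos.ne') hs.ne').congr_deriv ?_
  simp only [id]
  field_simp
  linear_combination hsq

/-- A primitive of the Konno density, up to the factor `1 / π`. -/
theorem hasDerivAt_arcsin_konno {a x : ℝ} (ha0 : 0 < a) (ha1 : a < 1)
    (hx : x ∈ Set.Ioo (-a) a) :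
    HasDerivAt
      (fun y : ℝ ↦ Real.arcsin (Real.sqrt (1 - a ^ 2) / a * (y / Real.sqrt (1 - y ^ 2))))
      (Real.sqrt (1 - a ^ 2) / ((1 - x ^ 2) * Real.sqrt (a ^ 2 - x ^ 2))) x := by
  have hxa : x ^ 2 < a ^ 2 := sq_lt_sq' hx.1 hx.2
  have ha : a ^ 2 < 1 := by nlinarith
  have hpos : 0 < 1 - x ^ 2 := by linarith
  have hs : 0 < Real.sqrt (1 - x ^ 2) := Real.sqrt_pos.2 hpos
  have hsq : Real.sqrt (1 - x ^ 2) ^ 2 = 1 - x ^ 2 := Real.sq_sqrt hpos.le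
  have hbsq : Real.sqrt (1 - a ^ 2) ^ 2 = 1 - a ^ 2 := Real.sq_sqrt (by linarith)
  have hd : 0 < Real.sqrt (a ^ 2 - x ^ 2) := Real.sqrt_pos.2 (by linarith)
  have hdsq : Real.sqrt (a ^ 2 - x ^ 2) ^ 2 = a ^ 2 - x ^ 2 := Real.sq_sqrt (by linarith)
  set b := Real.sqrt (1 - a ^ 2)
  set s := Real.sqrt (1 - x ^ 2) with hs_def
  set d := Real.sqrt (a ^ 2 - x ^ 2)
  have hcos : 1 - (b / a * (x / s)) ^ 2 = (d / (a * s)) ^ 2 := by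
    field_simp
    linear_combination a ^ 2 * hsq - x ^ 2 * hbsq - hdsq
  have hlt : (b / a * (x / s)) ^ 2 < 1 := by
    have : 0 < (d / (a * s)) ^ 2 := by positivity
    linarith
  obtain ⟨hl, hr⟩ := abs_lt.1 ((sq_lt_one_iff_abs_lt_one _).1 hlt)
  refine ((Real.hasDerivAt_arcsin hl.ne' hr.ne).comp x
    ((hasDerivAt_div_sqrt_one_sub_sq (by linarith)).const_mul (b / a))).congr_deriv ?_
  rw [← hs_def, hcos, Real.sqrt_sq (by positivity), ← hsq]
  field_simp

/-- The Konno density function integrates to one over its support `(-a, a)`. -/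
theorem konnoDensity_integral_eq_one (a : ℝ) (ha0 : 0 < a) (ha1 : a < 1) :
    ∫ x in Set.Ioo (-a) a,
      Real.sqrt (1 - a ^ 2) / (Real.pi * (1 - x ^ 2) * Real.sqrt (a ^ 2 - x ^ 2)) = 1 := by
  have ha : a ^ 2 < 1 := by nlinarith
  have hb : 0 < Real.sqrt (1 - a ^ 2) := Real.sqrt_pos.2 (by linarith)
  have hle : -a ≤ a := by linarith
  have hcont : ContinuousOn
      (fun y : ℝ ↦ Real.arcsin (Real.sqrt (1 - a ^ 2) / a * (y / Real.sqrt (1 - y ^ 2))))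
      (Set.Icc (-a) a) := by
    refine Real.continuous_arcsin.comp_continuousOn (continuousOn_const.mul
      (continuousOn_id.div (by fun_prop) fun x hx ↦ ?_))
    have : x ^ 2 ≤ a ^ 2 := sq_le_sq' hx.1 hx.2
    exact (Real.sqrt_pos.2 (by linarith)).ne'
  have hderiv := fun x (hx : x ∈ Set.Ioo (-a) a) ↦ hasDerivAt_arcsin_konno ha0 ha1 hx
  have hint : IntervalIntegrable
      (fun x ↦ Real.sqrt (1 - a ^ 2) / ((1 - x ^ 2) * Real.sqrt (a ^ 2 - x ^ 2)))
      volume (-a) a := by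
    apply intervalIntegral.intervalIntegrable_deriv_of_nonneg
    · rwa [Set.uIcc_of_le hle]
    · rwa [min_eq_left hle, max_eq_right hle]
    · rw [min_eq_left hle, max_eq_right hle]
      intro x hx
      have : x ^ 2 < a ^ 2 := sq_lt_sq' hx.1 hx.2
      have : 0 < 1 - x ^ 2 := by linarith
      positivity
  have hval : ∫ x in (-a)..a,
      Real.sqrt (1 - a ^ 2) / ((1 - x ^ 2) * Real.sqrt (a ^ 2 - x ^ 2)) = Real.pi := by
    rw [intervalIntegral.integral_eq_sub_of_hasDerivAt_of_le hle hcont hderiv hint]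
    have h1 : Real.sqrt (1 - a ^ 2) / a * (a / Real.sqrt (1 - a ^ 2)) = 1 := by field_simp
    rw [neg_sq, neg_div, mul_neg, h1, Real.arcsin_neg, Real.arcsin_one]
    ring
  rw [← integral_Ioc_eq_integral_Ioo, ← intervalIntegral.integral_of_le hle]
  simp_rw [mul_assoc, div_mul_eq_div_div_swap _ Real.pi]
  rw [intervalIntegral.integral_div, hval, div_self Real.pi_ne_zero]
end
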